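/- arXiv:2011.03420 — 3 statements merged into one kernel-verified Lean document; each statement's English description precedes it below -/
import Mathlib

section
/- Let S be an infinite set and let T ⊆ S be a subset with |T| = |S| (there is a bijection between T and S). Then there exists an action α of the free group F_S on the generating set S on the space X = {0,1}^S (with the product topology, where {0,1} is discrete) such that: (i) each α_g is a homeomorphism of X; (ii) the action is free, i.e. for every g ≠ 1 in F_S and every x ∈ X one has α_g(x) ≠ x; and (iii) the restriction of α to the subgroup of F_S generated by the generators indexed by T is minimal, i.e. for every x ∈ X the orbit of x under this subgroup is dense in X. -/
universe u

/-- Free groups are residually finite. -/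
theorem FreeGroup.exists_finite_hom_ne_one {S : Type u} {w : FreeGroup S} (hw : w ≠ 1) :
    ∃ (B : Type u) (_ : Finite B) (φ : FreeGroup S →* Equiv.Perm B), φ w ≠ 1 := by
  classical
  let B := {x : FreeGroup S // ∃ L, L <:+ w.toWord ∧ FreeGroup.mk L = x}
  have hB : Finite B := by
    refine Set.Finite.to_subtype (s := {x | ∃ L, L <:+ w.toWord ∧ FreeGroup.mk L = x}) ?_
    have : {x | ∃ L, L <:+ w.toWord ∧ FreeGroup.mk L = x}
        = FreeGroup.mk '' {L | L ∈ w.toWord.tails} := by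
      ext x; simp [List.mem_tails]
    rw [this]
    exact (List.finite_toSet _).image _
  have key (s : S) : ∃ σ : Equiv.Perm B, ∀ x y : B, y.1 = FreeGroup.of s * x.1 → σ x = y := by
    obtain ⟨σ, hσ⟩ := Equiv.Perm.exists_extending_pair
      (α := {p : B × B // p.2.1 = FreeGroup.of s * p.1.1})
      (fun p => p.1.1) (fun p => p.1.2)
      (by
        rintro ⟨⟨a, b⟩, h⟩ ⟨⟨c, d⟩, h'⟩ e
        simp only at h h' e
        subst e
        have : b = d := Subtype.ext (h.trans h'.symm)
        subst this; rfl)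
      (by
        rintro ⟨⟨a, b⟩, h⟩ ⟨⟨c, d⟩, h'⟩ e
        simp only at h h' e
        subst e
        have : a = c := Subtype.ext (mul_left_cancel (h.symm.trans h'))
        subst this; rfl)
    exact ⟨σ, fun x y h => hσ ⟨(x, y), h⟩⟩
  choose σ hσ using key
  have hone : ∃ L, L <:+ w.toWord ∧ FreeGroup.mk L = 1 := ⟨[], List.nil_suffix, rfl⟩
  have orbit (L : List (S × Bool)) (hL : L <:+ w.toWord) :
      FreeGroup.lift σ (FreeGroup.mk L) (⟨1, hone⟩ : B) = ⟨FreeGroup.mk L, L, hL, rfl⟩ := by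
    induction L with
    | nil => rfl
    | cons a L ih =>
      have hL' : L <:+ w.toWord := (List.suffix_cons a L).trans hL
      have split : FreeGroup.mk (a :: L) = FreeGroup.mk [a] * FreeGroup.mk L := rfl
      obtain ⟨s, b⟩ := a
      have e : FreeGroup.lift σ (FreeGroup.mk ((s, b) :: L)) (⟨1, hone⟩ : B)
          = FreeGroup.lift σ (FreeGroup.mk [(s, b)]) ⟨FreeGroup.mk L, L, hL', rfl⟩ := by
        rw [split, _root_.map_mul, Equiv.Perm.mul_apply, ih hL']
      rw [e]
      cases b with
      | true =>
        simp only [FreeGroup.lift_mk, List.map_cons, List.map_nil, List.prod_singleton, cond_true]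
        exact hσ s _ _ rfl
      | false =>
        simp only [FreeGroup.lift_mk, List.map_cons, List.map_nil, List.prod_singleton, cond_false]
        rw [Equiv.Perm.inv_eq_iff_eq]
        refine (hσ s _ _ ?_).symm
        have hinv : FreeGroup.mk [(s, false)] = (FreeGroup.of s)⁻¹ := rfl
        simp only [split, hinv, mul_inv_cancel_left]
  refine ⟨B, hB, FreeGroup.lift σ, fun h => hw ?_⟩
  have hfix := orbit w.toWord List.suffix_rfl
  simp only [FreeGroup.mk_toWord, h, Equiv.Perm.one_apply] at hfix
  exact (congrArg Subtype.val hfix).symm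

/-- The Cantor space is homeomorphic to a disjoint union of finitely many copies of itself. -/
theorem nonempty_fin_prod_cantor_homeomorph (n : ℕ) :
    Nonempty (Fin (n + 1) × (ℕ → Bool) ≃ₜ (ℕ → Bool)) := by
  induction n with
  | zero => exact ⟨Homeomorph.uniqueProd (Fin 1) (ℕ → Bool)⟩
  | succ n ih =>
    obtain ⟨k⟩ := ih
    have double : Fin 2 × (ℕ → Bool) ≃ₜ (ℕ → Bool) :=
      ((Homeomorph.ofDiscrete finTwoEquiv).prodCongr (Homeomorph.refl _)).trans <|
      ((Homeomorph.funUnique Unit Bool).symm.prodCongr (Homeomorph.refl _)).trans <|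
      Homeomorph.sumArrowHomeomorphProdArrow.symm.trans <|
      Homeomorph.piCongrLeft (Y := fun _ : ℕ => Bool)
        ((Equiv.sumComm Unit ℕ).trans Equiv.natSumPUnitEquivNat)
    have split (m : ℕ) : Fin (1 + m) × (ℕ → Bool) ≃ₜ
        (Fin 1 × (ℕ → Bool)) ⊕ (Fin m × (ℕ → Bool)) :=
      ((Homeomorph.ofDiscrete finSumFinEquiv.symm).prodCongr (Homeomorph.refl _)).trans
        Homeomorph.sumProdDistrib
    let one := Homeomorph.uniqueProd (Fin 1) (ℕ → Bool)
    have swap : Fin (n + 1 + 1) × (ℕ → Bool) ≃ₜ Fin (1 + (n + 1)) × (ℕ → Bool) :=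
      (Homeomorph.ofDiscrete (finCongr (by omega))).prodCongr (Homeomorph.refl _)
    exact ⟨swap.trans <| (split (n + 1)).trans <|
      ((Homeomorph.refl _).sumCongr (k.trans one.symm)).trans <| (split 1).symm.trans double⟩

/-- Every finite group acts freely on the Cantor space by homeomorphisms. -/
theorem exists_free_hom_cantor_homeomorph (H : Type*) [Group H] [Finite H] :
    ∃ ρ : H →* ((ℕ → Bool) ≃ₜ (ℕ → Bool)), ∀ h, h ≠ 1 → ∀ x, ρ h x ≠ x := by
  obtain ⟨n, ⟨e⟩⟩ := Finite.exists_equiv_fin H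
  obtain _ | n := n
  · exact (e 1).elim0
  obtain ⟨k⟩ := nonempty_fin_prod_cantor_homeomorph n
  refine ⟨{
    toFun := fun h => k.symm.trans
      (((Homeomorph.ofDiscrete (e.symm.trans ((Equiv.mulLeft h).trans e))).prodCongr
        (Homeomorph.refl _)).trans k)
    map_one' := ?_
    map_mul' := ?_ }, ?_⟩
  · ext1 x
    simp [Homeomorph.ofDiscrete]
  · intro a b
    ext1 x
    simp [Homeomorph.ofDiscrete, Prod.map]
  · intro h hh x hx
    have hx' := congrArg (fun y => e.symm (k.symm y).1) hx
    exact hh (by simpa [Homeomorph.ofDiscrete] using hx')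

/-- Every nontrivial element of a free group acts without fixed points in some action of the free
group on the Cantor space by homeomorphisms. -/
theorem FreeGroup.exists_cantor_homeomorph_forall_ne {S : Type*} {w : FreeGroup S} (hw : w ≠ 1) :
    ∃ β : S → ((ℕ → Bool) ≃ₜ (ℕ → Bool)), ∀ x, FreeGroup.lift β w x ≠ x := by
  obtain ⟨B, _, φ, hφ⟩ := FreeGroup.exists_finite_hom_ne_one hw
  obtain ⟨ρ, hρ⟩ := exists_free_hom_cantor_homeomorph (Equiv.Perm B)
  refine ⟨fun s => ρ (φ (FreeGroup.of s)), fun x => ?_⟩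
  have : FreeGroup.lift (fun s => ρ (φ (FreeGroup.of s))) = ρ.comp φ := by
    ext1 s; simp
  rw [this]
  exact hρ _ hφ x

theorem FreeGroup.lift_congr_of_toWord {S G : Type*} [DecidableEq S] [Group G] {f g : S → G}
    {w : FreeGroup S} (h : ∀ a ∈ w.toWord, f a.1 = g a.1) :
    FreeGroup.lift f w = FreeGroup.lift g w := by
  rw [← FreeGroup.mk_toWord (x := w), FreeGroup.lift_mk, FreeGroup.lift_mk]
  congr 1
  refine List.map_congr_left fun a ha => ?_
  rw [h a ha]

/-- Translation by `v` on the Boolean cube. -/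
def xorHomeomorph {ι : Type*} (v : ι → Bool) : (ι → Bool) ≃ₜ (ι → Bool) where
  toFun x := fun i => xor (v i) (x i)
  invFun x := fun i => xor (v i) (x i)
  left_inv x := by funext i; simp
  right_inv x := by funext i; simp
  continuous_toFun := continuous_pi fun i =>
    (continuous_of_discreteTopology (f := xor (v i))).comp (continuous_apply i)
  continuous_invFun := continuous_pi fun i =>
    (continuous_of_discreteTopology (f := xor (v i))).comp (continuous_apply i)

/-- The coordinatewise action of a product of groups of homeomorphisms, transported along a
homeomorphism. -/
def piHomeomorphPerm {X I C : Type*} [TopologicalSpace X] [TopologicalSpace C]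
    (k : X ≃ₜ (I → C)) : (I → (C ≃ₜ C)) →* Equiv.Perm X where
  toFun f := (k.trans ((Homeomorph.piCongrRight f).trans k.symm)).toEquiv
  map_one' := by ext1 x; exact k.symm_apply_apply x
  map_mul' f g := by
    ext1 x
    apply k.injective
    funext i
    simp [Equiv.Perm.mul_apply]

theorem piHomeomorphPerm_apply {X I C : Type*} [TopologicalSpace X] [TopologicalSpace C]
    (k : X ≃ₜ (I → C)) (f : I → (C ≃ₜ C)) (x : X) (i : I) :
    k (piHomeomorphPerm k f x) i = f i (k x i) := by
  simp [piHomeomorphPerm]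

theorem continuous_piHomeomorphPerm {X I C : Type*} [TopologicalSpace X] [TopologicalSpace C]
    (k : X ≃ₜ (I → C)) (f : I → (C ≃ₜ C)) : Continuous (piHomeomorphPerm k f) :=
  (k.trans ((Homeomorph.piCongrRight f).trans k.symm)).continuous

theorem mk_freeGroup_prod_nat (S : Type u) [Infinite S] :
    Cardinal.mk (FreeGroup S × ℕ) = Cardinal.mk S := by
  simp [Cardinal.mk_freeGroup, Cardinal.mul_aleph0_eq (Cardinal.aleph0_le_mk S)]

theorem nonempty_equiv_finset_prod_finset {S I J : Type u} [Infinite S] [Infinite I] [Infinite J]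
    (hI : Cardinal.mk I = Cardinal.mk S) (hJ : Cardinal.mk J = Cardinal.mk S) :
    Nonempty (S ≃ Finset I × Finset J) := by
  refine Cardinal.eq.1 ?_
  simp [Cardinal.mk_finset_of_infinite, hI, hJ,
    Cardinal.mul_eq_self (Cardinal.aleph0_le_mk S)]


/-- For an infinite set `S` and `T ⊆ S` with `|T| = |S|`, there is a free action of the
free group `F_S` on `{0,1}^S` by homeomorphisms whose restriction to the subgroup
generated by the generators indexed by `T` is minimal. -/
theorem exists_free_action_minimal_on_subgroup
    {S : Type} [Infinite S] (T : Set S) (hT : Nonempty (T ≃ S)) :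
    ∃ α : FreeGroup S →* Equiv.Perm (S → Bool),
      (∀ g : FreeGroup S, Continuous (α g : (S → Bool) → (S → Bool))) ∧
      (∀ g : FreeGroup S, g ≠ 1 → ∀ x : S → Bool, α g x ≠ x) ∧
      (∀ x : S → Bool,
        Dense {y : S → Bool | ∃ g ∈ Subgroup.closure (FreeGroup.of '' T), α g x = y}) := by
  classical
  have hI := mk_freeGroup_prod_nat S
  have hJ : Cardinal.mk ((FreeGroup S × ℕ) × ℕ) = Cardinal.mk S := by
    rw [Cardinal.mk_prod, hI]
    simp [Cardinal.mul_aleph0_eq (Cardinal.aleph0_le_mk S)]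
  obtain ⟨eS⟩ := Cardinal.eq.1 hJ.symm
  obtain ⟨eF⟩ := nonempty_equiv_finset_prod_finset hI hJ
  obtain ⟨eT⟩ := hT
  have labels : ∃ L : S → Finset (FreeGroup S × ℕ) × Finset ((FreeGroup S × ℕ) × ℕ),
      ∀ p, ∃ t ∈ T, L t = p := by
    refine ⟨fun s => if h : s ∈ T then eF (eT ⟨s, h⟩) else (∅, ∅), fun p => ?_⟩
    exact ⟨(eT.symm (eF.symm p)).1, (eT.symm (eF.symm p)).2, by simp⟩
  obtain ⟨L, hL⟩ := labels
  have free (w : FreeGroup S) : ∃ β : S → ((ℕ → Bool) ≃ₜ (ℕ → Bool)),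
      w ≠ 1 → ∀ x, FreeGroup.lift β w x ≠ x := by
    by_cases hw : w = 1
    · exact ⟨fun _ => 1, fun h => absurd hw h⟩
    · obtain ⟨β, hβ⟩ := FreeGroup.exists_cantor_homeomorph_forall_ne hw
      exact ⟨β, fun _ => hβ⟩
  choose β hβ using free
  let γ (i : FreeGroup S × ℕ) (s : S) : (ℕ → Bool) ≃ₜ (ℕ → Bool) :=
    if i ∈ (L s).1 then xorHomeomorph fun n => decide ((i, n) ∈ (L s).2) else β i.1 s
  let k : (S → Bool) ≃ₜ (FreeGroup S × ℕ → ℕ → Bool) :=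
    (Homeomorph.piCongrLeft (Y := fun _ => Bool) eS).trans Homeomorph.piCurry
  have hk (x : S → Bool) (s : S) : k x (eS s).1 (eS s).2 = x s :=
    Equiv.piCongrLeft_apply_apply (fun _ => Bool) eS x s
  let α := (piHomeomorphPerm k).comp (MonoidHom.pi fun i => FreeGroup.lift (γ i))
  have hα (g : FreeGroup S) (x : S → Bool) (i) :
      k (α g x) i = FreeGroup.lift (γ i) g (k x i) := piHomeomorphPerm_apply _ _ _ _
  refine ⟨α, fun g => continuous_piHomeomorphPerm _ _, fun g hg x hx => ?_, fun x => ?_⟩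
  · obtain ⟨n, hn⟩ := Infinite.exists_notMem_finset
      ((g.toWord.toFinset.biUnion fun a => (L a.1).1).image Prod.snd)
    have hγ : FreeGroup.lift (γ (g, n)) g = FreeGroup.lift (β g) g := by
      refine FreeGroup.lift_congr_of_toWord fun a ha => if_neg fun hmem => hn ?_
      exact Finset.mem_image.2 ⟨(g, n),
        Finset.mem_biUnion.2 ⟨a, List.mem_toFinset.2 ha, hmem⟩, rfl⟩
    have hfix := hα g x (g, n)
    rw [hx, hγ] at hfix
    exact hβ g hg _ hfix.symm
  · refine dense_iff_inter_open.2 fun U hU ⟨y, hy⟩ => ?_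
    obtain ⟨F, u, hu, hFU⟩ := isOpen_pi_iff.1 hU y hy
    obtain ⟨t, ht, hLt⟩ := hL (F.image fun s => (eS s).1,
      (F.filter fun s => x s ≠ y s).image eS)
    refine ⟨α (FreeGroup.of t) x, hFU fun s hs => ?_, FreeGroup.of t,
      Subgroup.subset_closure ⟨t, ht, rfl⟩, rfl⟩
    suffices α (FreeGroup.of t) x s = y s by rw [this]; exact (hu s hs).2
    have hmem : (eS s).1 ∈ (L t).1 := by
      rw [hLt]; exact Finset.mem_image_of_mem _ hs
    have hiff : eS s ∈ (L t).2 ↔ x s ≠ y s := by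
      rw [hLt]; simpa using fun _ => hs
    rw [← hk (α (FreeGroup.of t) x) s, hα, FreeGroup.lift_apply_of]
    simp only [γ, if_pos hmem]
    change xor (decide (eS s ∈ (L t).2)) (k x (eS s).1 (eS s).2) = y s
    rw [hk]
    simp only [hiff]
    cases x s <;> cases y s <;> rfl
end

section
/- Let S be a countable set. Then there exists an injective group homomorphism φ from the free group F_S on the generating set S into SL(2, ℝ) (the group of 2×2 real matrices of determinant 1, with its topology inherited from the matrix space) whose range is a discrete subgroup, i.e. the range of φ carries the discrete topology as a subspace of SL(2, ℝ). In other words, every countable free group can be realized as a discrete subgroup of SL(2, ℝ). -/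
/-- The topology on `SL(2, ℝ)` inherited from the space of `2 × 2` real matrices. -/
noncomputable instance : TopologicalSpace (Matrix.SpecialLinearGroup (Fin 2) ℝ) :=
  TopologicalSpace.induced
    (fun A => (A : Matrix (Fin 2) (Fin 2) ℝ)) inferInstance

open UpperHalfPlane in
/-- The points of the upper half-plane at Euclidean distance at most `1` from the integer `c`. -/
def integralHalfDisk (c : ℤ) : Set ℍ := {z | ‖(z : ℂ) - c‖ ≤ 1}

theorem integralHalfDisk_nonempty (c : ℤ) : (integralHalfDisk c).Nonempty :=
  ⟨⟨c + Complex.I, by simp⟩, by simp [integralHalfDisk]⟩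

theorem disjoint_integralHalfDisk {c d : ℤ} (h : 2 < |c - d|) :
    Disjoint (integralHalfDisk c) (integralHalfDisk d) := by
  refine Set.disjoint_left.2 fun z hc hd => ?_
  simp only [integralHalfDisk, Set.mem_ofPred_eq] at hc hd
  have h1 : ‖((c - d : ℤ) : ℂ)‖ ≤ 2 := by
    calc ‖((c - d : ℤ) : ℂ)‖ = ‖((z : ℂ) - d) - (z - c)‖ := by push_cast; ring_nf
      _ ≤ ‖(z : ℂ) - d‖ + ‖(z : ℂ) - c‖ := norm_sub_le _ _
      _ ≤ 2 := by linarith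
  rw [Complex.norm_intCast] at h1
  have h2 : |c - d| ≤ 2 := by exact_mod_cast h1
  omega

/-- The Möbius transformation `z ↦ a - 1 / (z - b)`, as an element of `SL(2, ℤ)`. -/
def diskPairing (a b : ℤ) : Matrix.SpecialLinearGroup (Fin 2) ℤ :=
  ⟨!![a, -(a * b) - 1; 1, -b], by simp [Matrix.det_fin_two_of]⟩

theorem norm_inv_le_one_of_one_lt_norm {w : ℂ} (h : 1 < ‖w‖) : ‖w⁻¹‖ ≤ 1 := by
  rw [norm_inv]
  exact inv_le_one_of_one_le₀ h.le

open scoped Pointwise in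
theorem diskPairing_smul_compl_subset (a b : ℤ) :
    diskPairing a b • (integralHalfDisk b)ᶜ ⊆ integralHalfDisk a := by
  rintro _ ⟨z, hz, rfl⟩
  simp only [integralHalfDisk, Set.mem_compl_iff, Set.mem_ofPred_eq, not_le] at hz ⊢
  have h0 : (z : ℂ) - b ≠ 0 := norm_pos_iff.1 (by linarith)
  have key : ((diskPairing a b • z : UpperHalfPlane) : ℂ) - a = -((z : ℂ) - b)⁻¹ := by
    rw [UpperHalfPlane.coe_specialLinearGroup_apply]
    simp only [diskPairing, Matrix.SpecialLinearGroup.coe_mk, Matrix.of_apply, Matrix.cons_val',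
      Matrix.cons_val_zero, Matrix.cons_val_one, Matrix.cons_val_fin_one, algebraMap_int_eq,
      eq_intCast]
    push_cast
    rw [one_mul, ← sub_eq_add_neg]
    field_simp
    ring
  simpa only [key, norm_neg] using norm_inv_le_one_of_one_lt_norm hz

theorem diskPairing_inv (a b : ℤ) : (diskPairing a b)⁻¹ = -diskPairing b a := by
  refine Subtype.ext ?_
  rw [Matrix.SpecialLinearGroup.coe_inv, Matrix.SpecialLinearGroup.coe_neg]
  simp only [diskPairing, Matrix.SpecialLinearGroup.coe_mk, Matrix.adjugate_fin_two_of]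
  simp [mul_comm, add_comm]

open scoped Pointwise in
theorem diskPairing_inv_smul_compl_subset (a b : ℤ) :
    (diskPairing a b)⁻¹ • (integralHalfDisk a)ᶜ ⊆ integralHalfDisk b := by
  rintro _ ⟨z, hz, rfl⟩
  have h := diskPairing_smul_compl_subset b a (Set.smul_mem_smul_set hz)
  rwa [← ModularGroup.SL_neg_smul, ← diskPairing_inv] at h

theorem injective_lift_diskPairing :
    Function.Injective (FreeGroup.lift fun n : ℕ => diskPairing (8 * n) (8 * n + 4)) := by
  refine FreeGroup.injective_lift_of_ping_pong _
    (fun n : ℕ => integralHalfDisk (8 * n)) (fun n : ℕ => integralHalfDisk (8 * n + 4))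
    (fun n => integralHalfDisk_nonempty _) ?_ ?_ ?_
    (fun n => diskPairing_smul_compl_subset _ _) (fun n => diskPairing_inv_smul_compl_subset _ _)
  · exact fun m n h => disjoint_integralHalfDisk (lt_abs.2 (by omega))
  · exact fun m n h => disjoint_integralHalfDisk (lt_abs.2 (by omega))
  · exact fun m n => disjoint_integralHalfDisk (lt_abs.2 (by omega))

theorem discreteTopology_range_map_intCast :
    DiscreteTopology
      (Set.range (Matrix.SpecialLinearGroup.map (n := Fin 2) (Int.castRingHom ℝ))) :=
  Matrix.SpecialLinearGroup.discreteSpecialLinearGroupIntRangeSL (n := Fin 2)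

/-- Every countable free group embeds as a discrete subgroup of `SL(2, ℝ)`. -/
theorem exists_discrete_embedding_freeGroup_SL2R
    {S : Type} [Countable S] :
    ∃ φ : FreeGroup S →* Matrix.SpecialLinearGroup (Fin 2) ℝ,
      Function.Injective φ ∧ DiscreteTopology (Set.range φ) := by
  obtain ⟨f, hf⟩ := exists_injective_nat S
  refine ⟨(Matrix.SpecialLinearGroup.map (Int.castRingHom ℝ)).comp
    ((FreeGroup.lift fun n : ℕ => diskPairing (8 * n) (8 * n + 4)).comp (FreeGroup.map f)),
    ?_, discreteTopology_range_map_intCast.of_subset ?_⟩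
  · simp only [MonoidHom.coe_comp]
    exact Matrix.SpecialLinearGroup.map_intCast_injective.comp
      (injective_lift_diskPairing.comp (FreeGroup.map_injective hf))
  · rintro _ ⟨w, rfl⟩
    exact ⟨_, rfl⟩
end

section
/- Let S be an infinite set and let X = {0,1}^S with the product topology (where {0,1} is discrete). Then the homeomorphism group of X acts transitively on nonempty proper clopen subsets: for any two clopen subsets Y, Z ⊆ X with Y, Z nonempty and Y ≠ X, Z ≠ X, there exists a homeomorphism h : X → X such that h(Y) = Z. -/
/-- A clopen subset of a Cantor cube is determined by finitely many coordinates. -/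
lemma IsClopen.exists_finset_forall_mem_iff {S : Type*} {Y : Set (S → Bool)} (hY : IsClopen Y) :
    ∃ F : Finset S, ∀ x y : S → Bool, (∀ i ∈ F, x i = y i) → (x ∈ Y ↔ y ∈ Y) := by
  classical
  suffices h : ∃ F : Finset S, ∀ x ∈ (Set.univ : Set (S → Bool)), ∀ y : S → Bool,
      (∀ i ∈ F, x i = y i) → (x ∈ Y ↔ y ∈ Y) by
    obtain ⟨F, hF⟩ := h
    exact ⟨F, fun x y => hF x (Set.mem_univ x) y⟩
  refine isCompact_univ.induction_on (p := fun s => ∃ F : Finset S, ∀ x ∈ s, ∀ y : S → Bool,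
    (∀ i ∈ F, x i = y i) → (x ∈ Y ↔ y ∈ Y)) ⟨∅, by simp⟩ ?_ ?_ ?_
  · rintro s t hst ⟨F, hF⟩
    exact ⟨F, fun x hx => hF x (hst hx)⟩
  · rintro s t ⟨F, hF⟩ ⟨G, hG⟩
    refine ⟨F ∪ G, ?_⟩
    rintro x (hx | hx) y hxy
    · exact hF x hx y fun i hi => hxy i (Finset.mem_union_left _ hi)
    · exact hG x hx y fun i hi => hxy i (Finset.mem_union_right _ hi)
  · intro x _
    have key : ∀ U : Set (S → Bool), IsOpen U → x ∈ U → ∃ t ∈ nhdsWithin x Set.univ,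
        ∃ F : Finset S, ∀ x ∈ t, ∀ y : S → Bool, (∀ i ∈ F, x i = y i) → x ∈ U ∧ y ∈ U := by
      intro U hU hx
      obtain ⟨F, u, hu, hsub⟩ := isOpen_pi_iff.1 hU x hx
      refine ⟨(F : Set S).pi u, ?_, F, fun z hz y hzy => ⟨hsub hz, hsub fun i hi => ?_⟩⟩
      · rw [nhdsWithin_univ]
        exact set_pi_mem_nhds F.finite_toSet fun i hi => (hu i hi).1.mem_nhds (hu i hi).2
      · rw [← hzy i hi]
        exact hz i hi
    by_cases hx : x ∈ Y
    · obtain ⟨t, ht, F, hF⟩ := key Y hY.isOpen hx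
      exact ⟨t, ht, F, fun z hz y hzy => iff_of_true (hF z hz y hzy).1 (hF z hz y hzy).2⟩
    · obtain ⟨t, ht, F, hF⟩ := key Yᶜ hY.compl.isOpen hx
      exact ⟨t, ht, F, fun z hz y hzy => iff_of_false (hF z hz y hzy).1 (hF z hz y hzy).2⟩

/-- An infinite Cantor cube is homeomorphic to the disjoint union of two copies of itself. -/
lemma nonempty_cantorCube_sum_self_homeomorph (S : Type*) [Infinite S] :
    Nonempty ((S → Bool) ⊕ (S → Bool) ≃ₜ (S → Bool)) := by
  have e : Nonempty (Unit ⊕ S ≃ S) := by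
    rw [← Cardinal.eq]
    simpa using Cardinal.add_eq_right (Cardinal.aleph0_le_mk S)
      (Cardinal.one_le_aleph0.trans (Cardinal.aleph0_le_mk S))
  obtain ⟨e⟩ := e
  exact ⟨((Homeomorph.uniqueProd Unit _).symm.sumCongr (Homeomorph.uniqueProd Unit _).symm).trans <|
    Homeomorph.sumProdDistrib.symm.trans <|
    (Equiv.boolEquivPUnitSumPUnit.{0, 0}.symm.toHomeomorphOfDiscrete.prodCongr (.refl _)).trans <|
    ((Homeomorph.funUnique Unit Bool).symm.prodCongr (.refl _)).trans <|
    Homeomorph.sumArrowHomeomorphProdArrow.symm.trans <|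
    Homeomorph.piCongrLeft (Y := fun _ => Bool) e⟩

lemma nonempty_fin_succ_prod_cantorCube_homeomorph (S : Type*) [Infinite S] (n : ℕ) :
    Nonempty (Fin (n + 1) × (S → Bool) ≃ₜ (S → Bool)) := by
  induction n with
  | zero =>
    rw [zero_add]
    exact ⟨Homeomorph.uniqueProd _ _⟩
  | succ n ih =>
    obtain ⟨f⟩ := ih
    obtain ⟨g⟩ := nonempty_cantorCube_sum_self_homeomorph S
    exact ⟨(finSumFinEquiv.symm.toHomeomorphOfDiscrete.prodCongr (.refl _)).trans <|
      Homeomorph.sumProdDistrib.trans <| (f.sumCongr (Homeomorph.uniqueProd _ _)).trans g⟩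

lemma nonempty_prod_cantorCube_homeomorph (A S : Type*) [TopologicalSpace A] [DiscreteTopology A]
    [Finite A] [Nonempty A] [Infinite S] : Nonempty (A × (S → Bool) ≃ₜ (S → Bool)) := by
  obtain ⟨n, ⟨e⟩⟩ := Finite.exists_equiv_fin A
  obtain _ | n := n
  · exact (e (Classical.arbitrary A)).elim0
  · obtain ⟨f⟩ := nonempty_fin_succ_prod_cantorCube_homeomorph S n
    exact ⟨(e.toHomeomorphOfDiscrete.prodCongr (.refl _)).trans f⟩

/-- A nonempty clopen subset of an infinite Cantor cube is homeomorphic to the whole cube. -/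
lemma IsClopen.nonempty_homeomorph_cantorCube {S : Type*} [Infinite S] {Y : Set (S → Bool)}
    (hY : IsClopen Y) (hne : Y.Nonempty) : Nonempty (Y ≃ₜ (S → Bool)) := by
  classical
  obtain ⟨F, hF⟩ := hY.exists_finset_forall_mem_iff
  let e := Homeomorph.piEquivPiSubtypeProd (fun i => i ∈ F) (fun _ : S => Bool)
  let A : Set ({i // i ∈ F} → Bool) := {a | e.symm (a, fun _ => false) ∈ Y}
  have hA : ∀ x, x ∈ Y ↔ e x ∈ A ×ˢ (Set.univ : Set ({i // i ∉ F} → Bool)) := by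
    intro x
    simp only [Set.mem_prod, Set.mem_univ, and_true, A, Set.mem_ofPred_eq]
    refine hF _ _ fun i hi => ?_
    simp [e, Homeomorph.piEquivPiSubtypeProd, Equiv.piEquivPiSubtypeProd, hi]
  obtain ⟨y, hy⟩ := hne
  have : Nonempty A := ⟨⟨_, ((hA y).1 hy).1⟩⟩
  have c : Nonempty ({i // i ∉ F} ≃ S) := by
    rw [← Cardinal.eq]
    exact Cardinal.mk_compl_finset_of_infinite F
  obtain ⟨c⟩ := c
  obtain ⟨f⟩ := nonempty_prod_cantorCube_homeomorph A S
  exact ⟨(e.subtype hA).trans <| (Homeomorph.Set.prod _ _).trans <|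
    ((Homeomorph.refl _).prodCongr ((Homeomorph.Set.univ _).trans
      (Homeomorph.piCongrLeft (Y := fun _ => Bool) c))).trans f⟩

/-- A clopen subset and its complement decompose the space as a disjoint union. -/
lemma IsClopen.exists_homeomorph_sum_compl {X : Type*} [TopologicalSpace X] {Y : Set X}
    (hY : IsClopen Y) : ∃ e : Y ⊕ (Yᶜ : Set X) ≃ₜ X,
      (∀ y, e (.inl y) = y) ∧ ∀ y, e (.inr y) = y := by
  classical
  refine ⟨(Equiv.Set.sumCompl Y).toHomeomorphOfContinuousOpen ?_ ?_, ?_, ?_⟩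
  · exact continuous_sum_dom.2 ⟨continuous_subtype_val, continuous_subtype_val⟩
  · exact isOpenMap_sum.2 ⟨hY.isOpen.isOpenMap_subtype_val, hY.compl.isOpen.isOpenMap_subtype_val⟩
  · exact fun _ => rfl
  · exact fun _ => rfl

/-- For an infinite set `S`, the homeomorphism group of `{0,1}^S` acts transitively on
nonempty proper clopen subsets. -/
theorem exists_homeomorph_mapping_clopen
    {S : Type} [Infinite S] (Y Z : Set (S → Bool))
    (hY : IsClopen Y) (hZ : IsClopen Z) (hYne : Y.Nonempty) (hZne : Z.Nonempty)
    (hYp : Y ≠ Set.univ) (hZp : Z ≠ Set.univ) :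
    ∃ h : (S → Bool) ≃ₜ (S → Bool), h '' Y = Z := by
  obtain ⟨a⟩ := hY.nonempty_homeomorph_cantorCube hYne
  obtain ⟨b⟩ := hZ.nonempty_homeomorph_cantorCube hZne
  obtain ⟨a'⟩ := hY.compl.nonempty_homeomorph_cantorCube (Set.nonempty_compl.2 hYp)
  obtain ⟨b'⟩ := hZ.compl.nonempty_homeomorph_cantorCube (Set.nonempty_compl.2 hZp)
  obtain ⟨d, hd, -⟩ := hY.exists_homeomorph_sum_compl
  obtain ⟨e, he, -⟩ := hZ.exists_homeomorph_sum_compl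
  have hdY : d.symm '' Y = Set.range Sum.inl := by
    rw [Homeomorph.image_symm, ← d.preimage_image (Set.range Sum.inl), ← Set.range_comp, show d ∘ Sum.inl = Subtype.val from funext hd, Subtype.range_coe]
  have heZ : Z = e '' Set.range Sum.inl := by
    rw [← Set.range_comp, show e ∘ Sum.inl = Subtype.val from funext he, Subtype.range_coe]
  let g := (a.trans b.symm).sumCongr (a'.trans b'.symm)
  have hg : g '' Set.range Sum.inl = Set.range Sum.inl := by
    rw [← Set.range_comp, show g ∘ Sum.inl = Sum.inl ∘ (a.trans b.symm) from rfl,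
      (a.trans b.symm).surjective.range_comp]
  refine ⟨d.symm.trans (g.trans e), ?_⟩
  rw [show ⇑(d.symm.trans (g.trans e)) = (e ∘ g) ∘ d.symm from rfl, Set.image_comp, Set.image_comp, hdY, hg, ← heZ]
end
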